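/- (Theorem 2.2, L² form) Let (Ω, m) be a measure space, t₀ ∈ ℝ, T ∈ (t₀, ∞], and ω : [t₀, T) × Ω → ℝ³ measurable in x and, for m-a.e. x, twice differentiable in t. Let μ : [t₀, T) × Ω → ℝ with μ(t,x) > 0, and let c₀ > 3 be a constant, such that for all t and m-a.e. x: ∂_tω(t,x) = μ(t,x) · ω(t,x) and ∂_t²ω(t,x) = c₀ · μ(t,x)² · ω(t,x). Assume ϖ(t) = ∫_Ω |ω(t,x)|² dm is finite and nonzero for all t, that ∂_tω(t,·) is square-integrable, that ϖ is differentiable with ϖ'(t) = 2∫_Ω ⟨ω, ∂_tω⟩ dm, and that g(t) = ∫_Ω ⟨ω, ∂_tω⟩ dm is differentiable with g'(t) = ∫_Ω (|∂_tω|² + ⟨ω, ∂_t²ω⟩) dm. Define v(t) = g(t)/ϖ(t)² and assume v₀ = v(t₀) > 0. Set ϖ₀ = ϖ(t₀) and T₀ = t₀ + 1/((c₀ − 3) ϖ₀ v₀). Then for every t ∈ [t₀, T) with t < T₀: ‖∂_tω(t,·)‖_{L²(Ω)} ≥ (ϖ₀^{1/2}/(c₀−3))/(T₀ − t); in particular T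 ≤ T₀, and if T = T₀ then limsup_{t↑T₀} ‖∂_tω(t,·)‖_{L²(Ω)} = ∞. -/

import Mathlib

open scoped RealInnerProductSpace
open MeasureTheory

/-- Cauchy–Schwarz for the integral of a pointwise inner product. -/
theorem sq_integral_inner_le {Ω F : Type*} [MeasurableSpace Ω] [NormedAddCommGroup F]
    [InnerProductSpace ℝ F] {m : Measure Ω} {f g : Ω → F}
    (hf : MemLp f 2 m) (hg : MemLp g 2 m) :
    (∫ x, ⟪f x, g x⟫ ∂m) ^ 2 ≤ (∫ x, ‖f x‖ ^ 2 ∂m) * ∫ x, ‖g x‖ ^ 2 ∂m := by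
  have inner_toLp : ∀ {u w : Ω → F} (hu : MemLp u 2 m) (hw : MemLp w 2 m),
      ⟪hu.toLp u, hw.toLp w⟫ = ∫ x, ⟪u x, w x⟫ ∂m := fun hu hw => by
    rw [L2.inner_def]
    refine integral_congr_ae ?_
    filter_upwards [hu.coeFn_toLp, hw.coeFn_toLp] with x hx hy
    rw [hx, hy]
  have h := real_inner_mul_inner_self_le (hf.toLp f) (hg.toLp g)
  rw [inner_toLp, inner_toLp, inner_toLp] at h
  simpa only [real_inner_self_eq_norm_sq, ← sq] using h

/-- If `E' = 2g`, `g' = (1 + c) D` and `g² ≤ E D` on an interval `S` with least element `t₀`,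
then `E` and `g` are nondecreasing and `E² / g` decreases at rate at least `(c - 3) E(t₀)`. -/
theorem sq_div_add_le_of_hasDerivWithinAt {S : Set ℝ} (hS : Convex ℝ S) {t₀ : ℝ}
    (ht₀ : IsLeast S t₀) {E g D : ℝ → ℝ} {c : ℝ} (hc : 3 ≤ c) (hE : ∀ t ∈ S, 0 < E t) (hg : ∀ t ∈ S, 0 ≤ g t)
    (hg₀ : 0 < g t₀) (hD : ∀ t ∈ S, 0 ≤ D t) (hgED : ∀ t ∈ S, g t ^ 2 ≤ E t * D t)
    (hE' : ∀ t ∈ S, HasDerivWithinAt E (2 * g t) S t)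
    (hg' : ∀ t ∈ S, HasDerivWithinAt g ((1 + c) * D t) S t) {t : ℝ} (ht : t ∈ S) :
    E t₀ ≤ E t ∧ 0 < g t ∧
      E t ^ 2 / g t + (c - 3) * E t₀ * (t - t₀) ≤ E t₀ ^ 2 / g t₀ := by
  have hEmono : MonotoneOn E S := monotoneOn_of_hasDerivWithinAt_nonneg hS
    (fun x hx => (hE' x hx).continuousWithinAt)
    (fun x hx => (hE' x (interior_subset hx)).mono interior_subset)
    fun x hx => mul_nonneg zero_le_two (hg x (interior_subset hx))
  have hgmono : MonotoneOn g S := monotoneOn_of_hasDerivWithinAt_nonneg hS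
    (fun x hx => (hg' x hx).continuousWithinAt)
    (fun x hx => (hg' x (interior_subset hx)).mono interior_subset)
    fun x hx => mul_nonneg (by linarith) (hD x (interior_subset hx))
  have hE₀ : ∀ x ∈ S, E t₀ ≤ E x := fun x hx => hEmono ht₀.1 hx (ht₀.2 hx)
  have hgpos : ∀ x ∈ S, 0 < g x := fun x hx => hg₀.trans_le (hgmono ht₀.1 hx (ht₀.2 hx))
  refine ⟨hE₀ t ht, hgpos t ht, ?_⟩
  have hderiv : ∀ x ∈ S, HasDerivWithinAt
      (fun s => E s ^ 2 / g s + (c - 3) * E t₀ * (s - t₀))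
      ((2 * E x * (2 * g x) * g x - E x ^ 2 * ((1 + c) * D x)) / g x ^ 2
        + (c - 3) * E t₀) S x := fun x hx => by
    refine ((((hE' x hx).pow 2).div (hg' x hx) (hgpos x hx).ne').add
      (((hasDerivWithinAt_id x S).sub_const t₀).const_mul ((c - 3) * E t₀))).congr_deriv ?_
    simp
  have hanti := antitoneOn_of_hasDerivWithinAt_nonpos hS
    (fun x hx => (hderiv x hx).continuousWithinAt)
    (fun x hx => (hderiv x (interior_subset hx)).mono interior_subset)
    fun x hx => by
      have hx := interior_subset hx
      have hgx := hgpos x hx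
      have hEx := hE x hx
      have hrate : (2 * E x * (2 * g x) * g x - E x ^ 2 * ((1 + c) * D x)) / g x ^ 2
          ≤ -((c - 3) * E x) := by
        rw [div_le_iff₀ (by positivity)]
        have := mul_le_mul_of_nonneg_left (hgED x hx)
          (mul_nonneg (by linarith : (0 : ℝ) ≤ 1 + c) hEx.le)
        linarith
      have := mul_le_mul_of_nonneg_left (hE₀ x hx) (sub_nonneg.2 hc)
      linarith
  simpa using hanti ht₀.1 ht (ht₀.2 ht)

/-- The scalar lower bound on `D` resulting from `E₀ ≤ E`, `g² ≤ E D` and a bound on `E² / g`. -/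
theorem sqrt_div_div_le_sqrt {E₀ E g D k δ : ℝ} (hE₀ : 0 < E₀) (hE : E₀ ≤ E) (hg : 0 < g)
    (hk : 0 < k) (hδ : 0 < δ) (hgED : g ^ 2 ≤ E * D) (h : E ^ 2 / g ≤ k * E₀ * δ) :
    √E₀ / k / δ ≤ √D := by
  have hEpos : 0 < E := hE₀.trans_le hE
  refine Real.le_sqrt_of_sq_le ?_
  rw [div_div, div_pow, Real.sq_sqrt hE₀.le, div_le_iff₀ (by positivity)]
  rw [div_le_iff₀ hg] at h
  have h1 : (E ^ 2) ^ 2 ≤ (k * E₀ * δ * g) ^ 2 := pow_le_pow_left₀ (by positivity) h 2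
  have h2 : (k * E₀ * δ) ^ 2 * g ^ 2 ≤ (k * E₀ * δ) ^ 2 * (E * D) :=
    mul_le_mul_of_nonneg_left hgED (by positivity)
  have h3 : E * E ^ 3 ≤ E * ((k * δ) ^ 2 * D * E₀ ^ 2) := by linarith
  have h4 : E ^ 3 ≤ (k * δ) ^ 2 * D * E₀ ^ 2 := le_of_mul_le_mul_left h3 hEpos
  have h5 : E₀ ^ 3 ≤ E ^ 3 := pow_le_pow_left₀ hE₀.le hE 3
  have h6 : E₀ * E₀ ^ 2 ≤ D * (k * δ) ^ 2 * E₀ ^ 2 := by linarith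
  exact le_of_mul_le_mul_right h6 (by positivity)

/-- Theorem 2.2, L² form: under the double alignment `∂_tω = μω`, `∂_t²ω = c₀μ²ω`
with `μ > 0` and `c₀ > 3`, and `v₀ = v(t₀) > 0`, the L² norm of `∂_tω` blows up no
later than `T₀ = t₀ + 1/((c₀ − 3) ϖ₀ v₀)`. -/
theorem stmt8 {Ω : Type*} [MeasurableSpace Ω] (m : Measure Ω)
    (t₀ : ℝ) (T : EReal) (hT : (t₀ : EReal) < T)
    (ω ω' ω'' : ℝ → Ω → EuclideanSpace ℝ (Fin 3))
    (μ : ℝ → Ω → ℝ) (c₀ : ℝ) (hc₀ : 3 < c₀)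
    (hmeas : ∀ t : ℝ, t₀ ≤ t → (t : EReal) < T →
      AEStronglyMeasurable (ω t) m ∧ AEStronglyMeasurable (ω' t) m)
    (hderiv : ∀ᵐ x ∂m, ∀ t : ℝ, t₀ ≤ t → (t : EReal) < T →
      HasDerivWithinAt (fun s => ω s x) (ω' t x) {s : ℝ | t₀ ≤ s ∧ (s : EReal) < T} t ∧
      HasDerivWithinAt (fun s => ω' s x) (ω'' t x) {s : ℝ | t₀ ≤ s ∧ (s : EReal) < T} t)
    (halign : ∀ t : ℝ, t₀ ≤ t → (t : EReal) < T → ∀ᵐ x ∂m,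
      0 < μ t x ∧
      ω' t x = μ t x • ω t x ∧
      ω'' t x = (c₀ * μ t x ^ 2) • ω t x)
    (hω2 : ∀ t : ℝ, t₀ ≤ t → (t : EReal) < T → Integrable (fun x => ‖ω t x‖ ^ 2) m)
    (hϖne : ∀ t : ℝ, t₀ ≤ t → (t : EReal) < T → (∫ x, ‖ω t x‖ ^ 2 ∂m) ≠ 0)
    (hω'2 : ∀ t : ℝ, t₀ ≤ t → (t : EReal) < T → Integrable (fun x => ‖ω' t x‖ ^ 2) m)
    (hϖderiv : ∀ t : ℝ, t₀ ≤ t → (t : EReal) < T →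
      HasDerivWithinAt (fun s => ∫ x, ‖ω s x‖ ^ 2 ∂m)
        (2 * ∫ x, ⟪ω t x, ω' t x⟫ ∂m) {s : ℝ | t₀ ≤ s ∧ (s : EReal) < T} t)
    (hgderiv : ∀ t : ℝ, t₀ ≤ t → (t : EReal) < T →
      HasDerivWithinAt (fun s => ∫ x, ⟪ω s x, ω' s x⟫ ∂m)
        (∫ x, (‖ω' t x‖ ^ 2 + ⟪ω t x, ω'' t x⟫) ∂m)
        {s : ℝ | t₀ ≤ s ∧ (s : EReal) < T} t)
    (v₀ : ℝ) (hv₀ : 0 < v₀)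
    (hv0 : (∫ x, ⟪ω t₀ x, ω' t₀ x⟫ ∂m) / (∫ x, ‖ω t₀ x‖ ^ 2 ∂m) ^ 2 = v₀) :
    (∀ t : ℝ, t₀ ≤ t → (t : EReal) < T →
      t < t₀ + 1 / ((c₀ - 3) * (∫ x, ‖ω t₀ x‖ ^ 2 ∂m) * v₀) →
      Real.sqrt (∫ x, ‖ω' t x‖ ^ 2 ∂m) ≥
        (Real.sqrt (∫ x, ‖ω t₀ x‖ ^ 2 ∂m) / (c₀ - 3)) /
          ((t₀ + 1 / ((c₀ - 3) * (∫ x, ‖ω t₀ x‖ ^ 2 ∂m) * v₀)) - t)) ∧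
    T ≤ ((t₀ + 1 / ((c₀ - 3) * (∫ x, ‖ω t₀ x‖ ^ 2 ∂m) * v₀) : ℝ) : EReal) ∧
    (T = ((t₀ + 1 / ((c₀ - 3) * (∫ x, ‖ω t₀ x‖ ^ 2 ∂m) * v₀) : ℝ) : EReal) →
      ∀ M : ℝ, ∃ᶠ t in nhdsWithin (t₀ + 1 / ((c₀ - 3) * (∫ x, ‖ω t₀ x‖ ^ 2 ∂m) * v₀))
        (Set.Iio (t₀ + 1 / ((c₀ - 3) * (∫ x, ‖ω t₀ x‖ ^ 2 ∂m) * v₀))),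
        M ≤ Real.sqrt (∫ x, ‖ω' t x‖ ^ 2 ∂m)) := by
  set S : Set ℝ := {s : ℝ | t₀ ≤ s ∧ (s : EReal) < T} with hSdef
  set E : ℝ → ℝ := fun s => ∫ x, ‖ω s x‖ ^ 2 ∂m with hEdef
  set g : ℝ → ℝ := fun s => ∫ x, ⟪ω s x, ω' s x⟫ ∂m with hgdef
  set D : ℝ → ℝ := fun s => ∫ x, ‖ω' s x‖ ^ 2 ∂m with hDdef
  have hS : Convex ℝ S := by
    refine Set.OrdConnected.convex ⟨fun x hx y hy z hz => ⟨hx.1.trans hz.1, ?_⟩⟩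
    exact (EReal.coe_le_coe_iff.2 hz.2).trans_lt hy.2
  have ht₀ : IsLeast S t₀ := ⟨⟨le_rfl, hT⟩, fun s hs => hs.1⟩
  have hE : ∀ t ∈ S, 0 < E t := fun t ht =>
    (integral_nonneg fun x => sq_nonneg _).lt_of_ne' (hϖne t ht.1 ht.2)
  have hg : ∀ t ∈ S, 0 ≤ g t := fun t ht => integral_nonneg_of_ae <| by
    filter_upwards [halign t ht.1 ht.2] with x hx
    rw [hx.2.1, real_inner_smul_right]
    exact mul_nonneg hx.1.le real_inner_self_nonneg
  have hD : ∀ t ∈ S, 0 ≤ D t := fun t _ => integral_nonneg fun x => sq_nonneg _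
  have hgED : ∀ t ∈ S, g t ^ 2 ≤ E t * D t := fun t ht =>
    have hm := hmeas t ht.1 ht.2
    sq_integral_inner_le ((memLp_two_iff_integrable_sq_norm hm.1).2 (hω2 t ht.1 ht.2))
      ((memLp_two_iff_integrable_sq_norm hm.2).2 (hω'2 t ht.1 ht.2))
  have hg' : ∀ t ∈ S, HasDerivWithinAt g ((1 + c₀) * D t) S t := fun t ht => by
    convert hgderiv t ht.1 ht.2 using 1
    rw [hDdef, ← integral_const_mul]
    refine integral_congr_ae ?_
    filter_upwards [halign t ht.1 ht.2] with x hx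
    rw [hx.2.1, hx.2.2, real_inner_smul_right, real_inner_self_eq_norm_sq, norm_smul, mul_pow,
      Real.norm_eq_abs, sq_abs]
    ring
  have hE₀ : 0 < E t₀ := hE t₀ ht₀.1
  have hg₀ : g t₀ = v₀ * E t₀ ^ 2 := (div_eq_iff (by positivity)).1 hv0
  have hk : 0 < c₀ - 3 := sub_pos.2 hc₀
  change (∀ t : ℝ, t₀ ≤ t → (t : EReal) < T → t < t₀ + 1 / ((c₀ - 3) * E t₀ * v₀) →
      √(E t₀) / (c₀ - 3) / (t₀ + 1 / ((c₀ - 3) * E t₀ * v₀) - t) ≤ √(D t)) ∧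
    T ≤ ((t₀ + 1 / ((c₀ - 3) * E t₀ * v₀) : ℝ) : EReal) ∧
    (T = ((t₀ + 1 / ((c₀ - 3) * E t₀ * v₀) : ℝ) : EReal) →
      ∀ M : ℝ, ∃ᶠ t in nhdsWithin (t₀ + 1 / ((c₀ - 3) * E t₀ * v₀))
        (Set.Iio (t₀ + 1 / ((c₀ - 3) * E t₀ * v₀))), M ≤ √(D t))
  set T₀ : ℝ := t₀ + 1 / ((c₀ - 3) * E t₀ * v₀) with hT₀
  have hkey : ∀ t ∈ S, E t₀ ≤ E t ∧ 0 < g t ∧ E t ^ 2 / g t ≤ (c₀ - 3) * E t₀ * (T₀ - t) :=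
    fun t ht => by
      obtain ⟨h1, h2, h3⟩ := sq_div_add_le_of_hasDerivWithinAt hS ht₀ hc₀.le hE hg
        (by rw [hg₀]; positivity) hD hgED (fun t ht => hϖderiv t ht.1 ht.2) hg' ht
      refine ⟨h1, h2, ?_⟩
      have h4 : E t₀ ^ 2 / g t₀ = (c₀ - 3) * E t₀ * (T₀ - t₀) := by
        rw [hg₀, hT₀]
        field_simp
        ring
      linarith
  have hlower : ∀ t ∈ S, t < T₀ → √(E t₀) / (c₀ - 3) / (T₀ - t) ≤ √(D t) := fun t ht hlt =>
    have h := hkey t ht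
    sqrt_div_div_le_sqrt hE₀ h.1 h.2.1 hk (sub_pos.2 hlt) (hgED t ht) h.2.2
  refine ⟨fun t h1 h2 => hlower t ⟨h1, h2⟩, ?_, fun hTT M => ?_⟩
  · by_contra! hlt
    have hmem : T₀ ∈ S := ⟨by rw [hT₀]; exact le_add_of_nonneg_right (by positivity), hlt⟩
    obtain ⟨-, h2, h3⟩ := hkey T₀ hmem
    have := div_pos (pow_pos (hE T₀ hmem) 2) h2
    rw [sub_self, mul_zero] at h3
    linarith
  · have hlt : t₀ < T₀ := EReal.coe_lt_coe_iff.1 (hTT ▸ hT)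
    have hlim : Filter.Tendsto (fun t => √(E t₀) / (c₀ - 3) / (T₀ - t))
        (nhdsWithin T₀ (Set.Iio T₀)) Filter.atTop := by
      simp_rw [div_eq_mul_inv _ (T₀ - _)]
      refine Filter.Tendsto.const_mul_atTop (by positivity) (tendsto_inv_nhdsGT_zero.comp ?_)
      refine tendsto_nhdsWithin_iff.2 ⟨?_, ?_⟩
      · exact ((continuous_const.sub continuous_id).tendsto' T₀ 0 (sub_self T₀)).mono_left
          nhdsWithin_le_nhds
      · filter_upwards [self_mem_nhdsWithin] with t ht using sub_pos.2 (Set.mem_Iio.1 ht)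
    refine Filter.Eventually.frequently ?_
    filter_upwards [hlim.eventually_ge_atTop M, Ioo_mem_nhdsLT hlt] with t hM ht
    exact hM.trans (hlower t ⟨ht.1.le, hTT ▸ EReal.coe_lt_coe_iff.2 ht.2⟩ ht.2)
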